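/- Let u be the simple Parry word associated with the substitution φ, and let R_s = m−1 if α_0 ≥ 2 and R_s = m + ℓ′ − 1 with ℓ′ = min{ℓ ≥ 1 : α_ℓ ≥ 1} if α_0 = 1. Let k, q ∈ ℕ and, for i = 1, 2, let n_i, K_i, Q_i ∈ ℕ satisfy n_i ≤ F_{k+K_i}, Q_i ≤ F_{K_i} and u_[n_i] = φ^k(u_[Q_i])·u_[q]. Suppose that for i = 1, 2 there exists an abelian co-decomposition of the pair consisting of φ^{K_i+R_s}(0) and the word obtained from φ^{K_i+R_s}(0)·u_[Q_i] by deleting its first Q_i letters, such that the set of ordered pairs (z_j, z̃_j) occurring in the co-decomposition for i = 1 equals the set of ordered pairs occurring in the co-decomposition for i = 2, and such that u_[q] is a prefix of φ^k(z̃) for every pair (z, z̃) in this common set. Then P^rel_u(n_1) = P^rel_u(n_2). -/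

import Mathlib

/-- The prefix of length `n` of the infinite word `u`. -/
def pref (u : ℕ → ℕ) (n : ℕ) : List ℕ := (List.range n).map u

/-- `w` is a factor of the infinite word `u`. -/
def IsFactor (u : ℕ → ℕ) (w : List ℕ) : Prop :=
  ∃ i : ℕ, w = (List.range w.length).map (fun j => u (i + j))

/-- The Parikh vector of `w`, viewed as a word over `{0, …, m-1}`. -/
def parikh (m : ℕ) (w : List ℕ) : Fin m → ℤ := fun ℓ => (w.count (ℓ : ℕ) : ℤ)

/-- The set of relative Parikh vectors of factors of `u` of length `n`. -/
def relParikhSet (m : ℕ) (u : ℕ → ℕ) (n : ℕ) : Set (Fin m → ℤ) :=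
  { v | ∃ w : List ℕ, IsFactor u w ∧ w.length = n ∧ v = parikh m w - parikh m (pref u n) }

/-- The extension of a substitution `φ` to finite words. -/
def substW (φ : ℕ → List ℕ) (w : List ℕ) : List ℕ := w.flatMap φ

/-- The `k`-th iterate of the substitution `φ`, applied to the word `w`. -/
def iterW (φ : ℕ → List ℕ) (k : ℕ) (w : List ℕ) : List ℕ := (substW φ)^[k] w

/-- The words `z 0, …, z h` and `zt 0, …, zt h` form an abelian co-decomposition
of the ordered pair `(v, w)`. -/
def IsCoDecomp (m : ℕ) (v w : List ℕ) {h : ℕ} (z zt : Fin (h + 1) → List ℕ) : Prop :=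
  (∀ j, z j ≠ []) ∧ (∀ j, zt j ≠ []) ∧
  (List.ofFn z).flatten = v ∧ (List.ofFn zt).flatten = w ∧
  (∀ j, parikh m (z j) = parikh m (zt j))

/-- The factor of length `n` of the infinite word `u` starting at position `a`. -/
def seg (u : ℕ → ℕ) (a n : ℕ) : List ℕ := (List.range n).map (fun j => u (a + j))

/-- The length of the image of the prefix of `u` of length `x` under `φ ^ k`; this is the position
at which the image of the letter `u x` starts. -/
def blockPos (φ : ℕ → List ℕ) (u : ℕ → ℕ) (k x : ℕ) : ℕ := (iterW φ k (pref u x)).length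

/-- The word `u` is the simple Parry word associated with the substitution `φ`. -/
structure IsSimpleParry (m : ℕ) (α : ℕ → ℕ) (φ : ℕ → List ℕ) (u : ℕ → ℕ) : Prop where
  two_le : 2 ≤ m
  one_le_zero : 1 ≤ α 0
  one_le_last : 1 ≤ α (m - 1)
  map_of_lt : ∀ ℓ, ℓ + 1 < m → φ ℓ = List.replicate (α ℓ) 0 ++ [ℓ + 1]
  map_last : φ (m - 1) = List.replicate (α (m - 1)) 0
  lt : ∀ i, u i < m
  fix : ∀ k : ℕ, iterW φ k [0] = pref u (iterW φ k [0]).length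

section Words

variable {u : ℕ → ℕ} {φ : ℕ → List ℕ}

@[simp] lemma length_pref (n : ℕ) : (pref u n).length = n := by simp [pref]

@[simp] lemma length_seg (a n : ℕ) : (seg u a n).length = n := by simp [seg]

lemma pref_add (a b : ℕ) : pref u (a + b) = pref u a ++ seg u a b := by
  simp [pref, seg, List.range_add]

lemma pref_one : pref u 1 = [u 0] := by simp [pref]

lemma seg_one (a : ℕ) : seg u a 1 = [u a] := by simp [seg]

lemma seg_congr {a b n : ℕ} (h : ∀ i < n, u (a + i) = u (b + i)) : seg u a n = seg u b n := by
  simpa [seg] using h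

lemma eq_of_seg_eq {a b n : ℕ} (h : seg u a n = seg u b n) :
    ∀ i < n, u (a + i) = u (b + i) := by
  simpa [seg] using h

lemma take_pref {a n : ℕ} (h : a ≤ n) : (pref u n).take a = pref u a := by
  obtain ⟨b, rfl⟩ := Nat.exists_eq_add_of_le h
  rw [pref_add]; simp

lemma take_seg {a b n : ℕ} (h : b ≤ n) : (seg u a n).take b = seg u a b := by
  simp [seg, ← List.map_take, List.take_range, h]

lemma eq_pref_of_prefix {w : List ℕ} {n : ℕ} (h : w <+: pref u n) : w = pref u w.length := by
  have hl := h.length_le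
  rw [length_pref] at hl
  rw [← take_pref hl]
  exact List.prefix_iff_eq_take.mp h

lemma substW_append (v w : List ℕ) : substW φ (v ++ w) = substW φ v ++ substW φ w := by
  simp [substW]

lemma iterW_succ (k : ℕ) (w : List ℕ) : iterW φ (k + 1) w = substW φ (iterW φ k w) :=
  Function.iterate_succ_apply' _ _ _

lemma iterW_one (w : List ℕ) : iterW φ 1 w = substW φ w := rfl

lemma iterW_add (a b : ℕ) (w : List ℕ) : iterW φ (a + b) w = iterW φ a (iterW φ b w) :=
  Function.iterate_add_apply _ _ _ _

lemma iterW_append (k : ℕ) (v w : List ℕ) :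
    iterW φ k (v ++ w) = iterW φ k v ++ iterW φ k w := by
  induction k with
  | zero => rfl
  | succ k ih => simp only [iterW_succ, ih, substW_append]

lemma iterW_nil (k : ℕ) : iterW φ k [] = [] := by
  induction k with
  | zero => rfl
  | succ k ih => rw [iterW_succ, ih]; rfl

lemma iterW_flatten (k : ℕ) (L : List (List ℕ)) :
    iterW φ k L.flatten = (L.map (iterW φ k)).flatten := by
  induction L with
  | nil => exact iterW_nil k
  | cons a L ih => simp [iterW_append, ih]

lemma iterW_perm (k : ℕ) {v w : List ℕ} (h : v.Perm w) : (iterW φ k v).Perm (iterW φ k w) := by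
  induction k with
  | zero => exact h
  | succ k ih => rw [iterW_succ, iterW_succ]; exact ih.flatMap_right _

lemma blockPos_zero (k : ℕ) : blockPos φ u k 0 = 0 := by
  simp [blockPos, pref, iterW_nil]

lemma blockPos_add_right (k a b : ℕ) :
    blockPos φ u k (a + b) = blockPos φ u k a + (iterW φ k (seg u a b)).length := by
  simp only [blockPos, pref_add, iterW_append, List.length_append]

lemma blockPos_one_succ (x : ℕ) :
    blockPos φ u 1 (x + 1) = blockPos φ u 1 x + (φ (u x)).length := by
  rw [blockPos_add_right, seg_one, iterW_one]
  simp [substW]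

end Words

section Parikh

variable {m : ℕ}

lemma parikh_append (v w : List ℕ) : parikh m (v ++ w) = parikh m v + parikh m w := by
  funext ℓ; simp [parikh]

lemma parikh_perm {v w : List ℕ} (h : v.Perm w) : parikh m v = parikh m w := by
  funext ℓ; simp [parikh, h.count_eq]

lemma perm_of_parikh_eq {v w : List ℕ} (hv : ∀ x ∈ v, x < m) (hw : ∀ x ∈ w, x < m)
    (h : parikh m v = parikh m w) : v.Perm w := by
  rw [List.perm_iff_count]
  intro a
  by_cases ha : a < m
  · have := congrFun h ⟨a, ha⟩
    simpa [parikh] using this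
  · rw [List.count_eq_zero_of_not_mem fun hm => ha (hv a hm),
      List.count_eq_zero_of_not_mem fun hm => ha (hw a hm)]

/-- The differences of Parikh vectors of proper prefixes of `A` and `B` of equal length. -/
def prefixDiff (m : ℕ) (A B : List ℕ) : Set (Fin m → ℤ) :=
  { v | ∃ i < A.length, v = parikh m (B.take i) - parikh m (A.take i) }

lemma prefixDiff_append {A A' B B' : List ℕ} (h : A.Perm B) :
    prefixDiff m (A ++ A') (B ++ B') = prefixDiff m A B ∪ prefixDiff m A' B' := by
  have hl := h.length_eq
  have hp := parikh_perm (m := m) h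
  ext v
  constructor
  · rintro ⟨i, hi, rfl⟩
    by_cases hiA : i < A.length
    · refine Or.inl ⟨i, hiA, ?_⟩
      rw [List.take_append_of_le_length hiA.le, List.take_append_of_le_length (hl ▸ hiA.le)]
    · obtain ⟨d, rfl⟩ := Nat.exists_eq_add_of_le (not_lt.mp hiA)
      refine Or.inr ⟨d, by simpa using hi, ?_⟩
      rw [List.take_length_add_append, hl, List.take_length_add_append, parikh_append,
        parikh_append, hp]
      abel
  · rintro (⟨i, hi, rfl⟩ | ⟨i, hi, rfl⟩)
    · refine ⟨i, by simp; omega, ?_⟩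
      rw [List.take_append_of_le_length hi.le, List.take_append_of_le_length (hl ▸ hi.le)]
    · refine ⟨A.length + i, by simpa using hi, ?_⟩
      rw [List.take_length_add_append, hl, List.take_length_add_append, parikh_append,
        parikh_append, hp]
      abel

lemma prefixDiff_flatten {ι : Type*} (L : List ι) (A B : ι → List ℕ)
    (h : ∀ x ∈ L, (A x).Perm (B x)) :
    prefixDiff m (L.map A).flatten (L.map B).flatten =
      { v | ∃ x ∈ L, v ∈ prefixDiff m (A x) (B x) } := by
  induction L with
  | nil => ext v; simp [prefixDiff]
  | cons a L ih =>
    simp only [List.map_cons, List.flatten_cons]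
    rw [prefixDiff_append (h a (by simp)), ih fun x hx => h x (by simp [hx])]
    ext v
    simp

end Parikh

/-- The word obtained from `w ++ x` by deleting its first `x.length` letters. -/
def conj (x w : List ℕ) : List ℕ := (w ++ x).drop x.length

lemma append_conj {x w : List ℕ} (h : x <+: w) : x ++ conj x w = w ++ x := by
  obtain ⟨t, rfl⟩ := h
  simp [conj]

lemma perm_conj {x w : List ℕ} (h : x <+: w) : w.Perm (conj x w) := by
  obtain ⟨t, rfl⟩ := h
  simpa [conj] using List.perm_append_comm

lemma append_flatten_conj {ι : Type*} (x : List ℕ) (L : List ι) (B : ι → List ℕ)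
    (h : ∀ y ∈ L, x <+: B y) :
    x ++ (L.map fun y => conj x (B y)).flatten = (L.map B).flatten ++ x := by
  induction L with
  | nil => simp
  | cons a L ih =>
    simp only [List.map_cons, List.flatten_cons]
    rw [List.append_assoc, ← ih fun y hy => h y (by simp [hy]), ← List.append_assoc,
      append_conj (h a (by simp)), List.append_assoc]

lemma exists_block {f : ℕ → ℕ} (hf : StrictMono f) (h0 : f 0 = 0) (y : ℕ) :
    ∃ x, f x ≤ y ∧ y < f (x + 1) := by
  induction y with
  | zero => exact ⟨0, h0.le, h0 ▸ hf (by omega)⟩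
  | succ y ih =>
    obtain ⟨x, h1, h2⟩ := ih
    by_cases h : y + 1 < f (x + 1)
    · exact ⟨x, by omega, h⟩
    · have := hf (Nat.lt_succ_self (x + 1))
      exact ⟨x + 1, by omega, by simp only [Nat.succ_eq_add_one] at this; omega⟩

namespace IsSimpleParry

variable {m : ℕ} {α : ℕ → ℕ} {φ : ℕ → List ℕ} {u : ℕ → ℕ}

lemma apply_zero (h : IsSimpleParry m α φ u) : u 0 = 0 := by
  have := h.fix 0
  simp [iterW, pref] at this
  exact this.symm

lemma iterW_zero_length (h : IsSimpleParry m α φ u) (k : ℕ) :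
    (iterW φ k [0]).length = blockPos φ u k 1 := by
  rw [blockPos, pref_one, h.apply_zero]

lemma length_map_pos (h : IsSimpleParry m α φ u) {a : ℕ} (ha : a < m) : 1 ≤ (φ a).length := by
  by_cases h1 : a + 1 < m
  · rw [h.map_of_lt a h1]; simp
  · have h2 : a = m - 1 := by omega
    have := h.one_le_last
    rw [h2, h.map_last]; simpa using this

lemma length_map_zero (h : IsSimpleParry m α φ u) : 2 ≤ (φ 0).length := by
  have h2 := h.two_le
  have := h.one_le_zero
  rw [h.map_of_lt 0 (by omega)]
  simpa using this

lemma length_le_substW (h : IsSimpleParry m α φ u) (w : List ℕ) (hw : ∀ x ∈ w, x < m) :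
    w.length ≤ (substW φ w).length := by
  induction w with
  | nil => simp
  | cons a w ih =>
    have h1 := h.length_map_pos (hw a (by simp))
    have h2 := ih fun x hx => hw x (by simp [hx])
    simp only [substW, List.flatMap_cons, List.length_append, List.length_cons] at *
    omega

lemma seg_lt (h : IsSimpleParry m α φ u) (a n : ℕ) : ∀ x ∈ seg u a n, x < m := by
  intro x hx
  simp only [seg, List.mem_map] at hx
  obtain ⟨i, -, rfl⟩ := hx
  exact h.lt _

lemma pref_lt (h : IsSimpleParry m α φ u) (n : ℕ) : ∀ x ∈ pref u n, x < m := by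
  intro x hx
  simp only [pref, List.mem_map] at hx
  obtain ⟨i, -, rfl⟩ := hx
  exact h.lt _

lemma succ_le_length_substW (h : IsSimpleParry m α φ u) {x : ℕ} (hx : 1 ≤ x) :
    x + 1 ≤ (substW φ (pref u x)).length := by
  obtain ⟨y, rfl⟩ := Nat.exists_eq_add_of_le hx
  rw [pref_add, pref_one, substW_append, h.apply_zero, List.length_append]
  have h1 := h.length_le_substW _ (h.seg_lt 1 y)
  have h2 := h.length_map_zero
  have h3 : substW φ [0] = φ 0 := by simp [substW]
  rw [length_seg] at h1
  rw [h3]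
  omega

lemma succ_le_length_iterW (h : IsSimpleParry m α φ u) (s : ℕ) :
    s + 1 ≤ (iterW φ s [0]).length := by
  induction s with
  | zero => simp [iterW]
  | succ s ih =>
    rw [iterW_succ, h.fix s]
    have := h.succ_le_length_substW (x := (iterW φ s [0]).length) (by omega)
    omega

lemma iterW_pref (h : IsSimpleParry m α φ u) (k x : ℕ) :
    iterW φ k (pref u x) = pref u (blockPos φ u k x) := by
  have hx : x ≤ (iterW φ x [0]).length := by have := h.succ_le_length_iterW x; omega
  refine eq_pref_of_prefix (n := (iterW φ (k + x) [0]).length) ?_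
  rw [← h.fix, iterW_add, h.fix x]
  obtain ⟨b, hb⟩ := Nat.exists_eq_add_of_le hx
  rw [hb, pref_add, iterW_append]
  exact List.prefix_append _ _

lemma blockPos_add (h : IsSimpleParry m α φ u) (a b x : ℕ) :
    blockPos φ u (a + b) x = blockPos φ u a (blockPos φ u b x) := by
  rw [blockPos, iterW_add, h.iterW_pref b]; rfl

lemma iterW_seg (h : IsSimpleParry m α φ u) (k a b : ℕ) :
    iterW φ k (seg u a b) = seg u (blockPos φ u k a) (iterW φ k (seg u a b)).length := by
  have h1 := h.iterW_pref k (a + b)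
  rw [blockPos_add_right, pref_add, pref_add, iterW_append, h.iterW_pref k a] at h1
  exact List.append_cancel_left h1

lemma transport (h : IsSimpleParry m α φ u) (k : ℕ) {a b c : ℕ}
    (hab : ∀ i < c, u (a + i) = u (b + i)) :
    ∃ l, blockPos φ u k (a + c) = blockPos φ u k a + l ∧
      blockPos φ u k (b + c) = blockPos φ u k b + l ∧
      ∀ s < l, u (blockPos φ u k a + s) = u (blockPos φ u k b + s) := by
  have hs := seg_congr hab
  refine ⟨_, blockPos_add_right k a c, by rw [blockPos_add_right, hs], ?_⟩
  apply eq_of_seg_eq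
  rw [← h.iterW_seg, hs, ← h.iterW_seg]

lemma map_apply (h : IsSimpleParry m α φ u) (x : ℕ) :
    φ (u x) = seg u (blockPos φ u 1 x) (φ (u x)).length := by
  have := h.iterW_seg 1 x 1
  rw [seg_one, iterW_one] at this
  simpa [substW] using this

lemma apply_blockPos_add (h : IsSimpleParry m α φ u) {x t : ℕ} (ht : t < (φ (u x)).length) :
    u (blockPos φ u 1 x + t) = (φ (u x))[t] := by
  have := h.map_apply x
  rw [List.getElem_of_eq this ht]
  simp [seg]

lemma blockPos_strictMono (h : IsSimpleParry m α φ u) (k : ℕ) :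
    StrictMono (blockPos φ u k) := by
  induction k with
  | zero =>
    intro a b hab
    simpa [blockPos, iterW] using hab
  | succ k ih =>
    have h1 : StrictMono (blockPos φ u 1) := strictMono_nat_of_lt_succ fun x => by
      rw [blockPos_one_succ]
      have := h.length_map_pos (h.lt x)
      omega
    intro a b hab
    rw [Nat.add_comm, h.blockPos_add, h.blockPos_add]
    exact h1 (ih hab)

lemma blockPos_one_mono (h : IsSimpleParry m α φ u) {s s' : ℕ} (hs : s ≤ s') :
    blockPos φ u s 1 ≤ blockPos φ u s' 1 := by
  obtain ⟨d, rfl⟩ := Nat.exists_eq_add_of_le hs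
  rw [Nat.add_comm, h.blockPos_add]
  exact (h.blockPos_strictMono d).le_apply

lemma blockPos_succ_one (h : IsSimpleParry m α φ u) (s : ℕ) :
    blockPos φ u (s + 1) 1 = blockPos φ u 1 (blockPos φ u s 1) := by
  rw [Nat.add_comm, h.blockPos_add]

lemma apply_inner (h : IsSimpleParry m α φ u) {x t : ℕ} (ht : t + 1 < (φ (u x)).length) :
    u (blockPos φ u 1 x + t) = 0 := by
  rw [h.apply_blockPos_add (by omega)]
  have hx := h.lt x
  by_cases h1 : u x + 1 < m
  · have h2 := h.map_of_lt _ h1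
    have h3 : t < α (u x) := by simpa [h2] using ht
    simp [h2, h3]
  · have h2 : φ (u x) = List.replicate (α (m - 1)) 0 := by
      rw [← h.map_last]; congr 1; omega
    simp [h2]

lemma apply_last_block (h : IsSimpleParry m α φ u) {x t : ℕ} (hx : u x + 1 = m)
    (ht : t < (φ (u x)).length) : u (blockPos φ u 1 x + t) = 0 := by
  rw [h.apply_blockPos_add ht]
  have h2 : φ (u x) = List.replicate (α (m - 1)) 0 := by
    rw [← h.map_last]; congr 1; omega
  simp [h2]

lemma apply_block_end (h : IsSimpleParry m α φ u) {x y : ℕ} (hx : u x + 1 < m)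
    (hy : y + 1 = blockPos φ u 1 (x + 1)) : u y = u x + 1 := by
  have h2 := h.map_of_lt _ hx
  have h3 : (φ (u x)).length = α (u x) + 1 := by simp [h2]
  have h4 : y = blockPos φ u 1 x + α (u x) := by
    have := blockPos_one_succ (φ := φ) (u := u) x
    omega
  rw [h4, h.apply_blockPos_add (by omega)]
  simp [h2]

lemma apply_block_start (h : IsSimpleParry m α φ u) {x : ℕ} (hx : 1 ≤ α (u x)) :
    u (blockPos φ u 1 x) = 0 := by
  by_cases h1 : u x + 1 < m
  · have h2 := h.map_of_lt _ h1
    exact h.apply_inner (t := 0) (by simp [h2]; omega)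
  · have h3 := h.length_map_pos (h.lt x)
    have h4 := h.lt x
    exact h.apply_last_block (t := 0) (by omega) (by omega)

lemma apply_block_start_zero (h : IsSimpleParry m α φ u) {x : ℕ} (hx : u x = 0) :
    u (blockPos φ u 1 x) = 0 :=
  h.apply_block_start (hx ▸ h.one_le_zero)

/-- A factor all of whose letters but possibly the first are nonzero and which ends with `L + 1`
is a suffix of the image of such a factor ending with `L`. -/
lemma exists_parent (h : IsSimpleParry m α φ u) {j r L : ℕ}
    (hne : ∀ i, 1 ≤ i → i ≤ r → u (j + i) ≠ 0) (hL : u (j + r) = L + 1) :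
    ∃ j' r', (∀ i, 1 ≤ i → i ≤ r' → u (j' + i) ≠ 0) ∧ u (j' + r') = L ∧
      ∀ p', (∀ i ≤ r', u (p' + i) = u (j' + i)) →
        ∃ p, (∀ i ≤ r, u (p + i) = u (j + i)) ∧ p < blockPos φ u 1 (p' + 1) ∧
          p + r + 1 = blockPos φ u 1 (p' + r' + 1) := by
  have hmono := h.blockPos_strictMono 1
  obtain ⟨e, he1, he2⟩ := exists_block hmono (blockPos_zero 1) (j + r)
  obtain ⟨j', hj1, hj2⟩ := exists_block hmono (blockPos_zero 1) j
  have hje : j' ≤ e := by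
    by_contra hcon
    have := hmono.monotone (show e + 1 ≤ j' by omega)
    omega
  obtain ⟨r', rfl⟩ := Nat.exists_eq_add_of_le hje
  obtain ⟨t, ht⟩ := Nat.exists_eq_add_of_le hj1
  obtain ⟨t', ht'⟩ := Nat.exists_eq_add_of_le he1
  have hs := blockPos_one_succ (φ := φ) (u := u) (j' + r')
  have hm : u (j' + r') + 1 ≠ m := by
    intro hm
    have := h.apply_last_block (t := t') hm (by omega)
    rw [← ht'] at this
    omega
  have hm' := h.lt (j' + r')
  have hend : j + r + 1 = blockPos φ u 1 (j' + r' + 1) := by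
    by_contra hcon
    have := h.apply_inner (x := j' + r') (t := t') (by omega)
    rw [← ht'] at this
    omega
  refine ⟨j', r', ?_, ?_, ?_⟩
  · intro i hi1 hi2 h0
    have h1 := h.apply_block_start_zero h0
    have h2 := hmono.monotone (show j' + 1 ≤ j' + i by omega)
    have h3 := hmono.monotone (show j' + i ≤ j' + r' by omega)
    apply hne (blockPos φ u 1 (j' + i) - j) (by omega) (by omega)
    rw [← h1]
    congr 1
    omega
  · have := h.apply_block_end (by omega) hend
    omega
  · intro p' hp'
    obtain ⟨l, hl1, hl2, hl3⟩ := h.transport 1 (a := p') (b := j') (c := r' + 1)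
      fun i hi => hp' i (by omega)
    obtain ⟨l', hl1', hl2', -⟩ := h.transport 1 (a := p') (b := j') (c := 1)
      fun i hi => hp' i (by omega)
    rw [← add_assoc] at hl1 hl2
    refine ⟨blockPos φ u 1 p' + t, ?_, by omega, by omega⟩
    intro i hi
    rw [add_assoc, hl3 _ (by omega)]
    congr 1
    omega

/-- The induction step for locating early occurrences followed by the letter `0`. -/
lemma early_step (h : IsSimpleParry m α φ u) {s L : ℕ}
    (ih : ∀ j r, (∀ i, 1 ≤ i → i ≤ r → u (j + i) ≠ 0) → u (j + r) = L →
      ∃ p < blockPos φ u s 1, (∀ i ≤ r, u (p + i) = u (j + i)) ∧ u (p + r + 1) = 0)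
    {j r : ℕ} (hne : ∀ i, 1 ≤ i → i ≤ r → u (j + i) ≠ 0) (hL : u (j + r) = L + 1) :
    ∃ p < blockPos φ u (s + 1) 1, (∀ i ≤ r, u (p + i) = u (j + i)) ∧ u (p + r + 1) = 0 := by
  obtain ⟨j', r', h1, h2, h3⟩ := h.exists_parent hne hL
  obtain ⟨p', hp', hm, hz⟩ := ih j' r' h1 h2
  obtain ⟨p, hp1, hp2, hp3⟩ := h3 p' hm
  refine ⟨p, ?_, hp1, ?_⟩
  · rw [h.blockPos_succ_one]
    exact hp2.trans_le ((h.blockPos_strictMono 1).monotone hp')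
  · rw [hp3]
    exact h.apply_block_start_zero hz

lemma early_base {s : ℕ}
    (hz : ∃ p < blockPos φ u s 1, u p = 0 ∧ u (p + 1) = 0)
    {j r : ℕ} (hne : ∀ i, 1 ≤ i → i ≤ r → u (j + i) ≠ 0) (hL : u (j + r) = 0) :
    ∃ p < blockPos φ u s 1, (∀ i ≤ r, u (p + i) = u (j + i)) ∧ u (p + r + 1) = 0 := by
  have hr : r = 0 := by
    by_contra hr
    exact hne r (by omega) le_rfl hL
  subst hr
  obtain ⟨p, hp, h1, h2⟩ := hz
  refine ⟨p, hp, ?_, h2⟩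
  intro i hi
  obtain rfl : i = 0 := by omega
  rw [hL]
  exact h1

lemma early_of_base (h : IsSimpleParry m α φ u) {s : ℕ}
    (hz : ∃ p < blockPos φ u s 1, u p = 0 ∧ u (p + 1) = 0) (L : ℕ) :
    ∀ j r, (∀ i, 1 ≤ i → i ≤ r → u (j + i) ≠ 0) → u (j + r) = L →
      ∃ p < blockPos φ u (s + L) 1, (∀ i ≤ r, u (p + i) = u (j + i)) ∧ u (p + r + 1) = 0 := by
  induction L with
  | zero => exact fun j r hne hL => early_base hz hne hL
  | succ L ih => exact fun j r hne hL => h.early_step ih hne hL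

lemma apply_one_of_two_le (h : IsSimpleParry m α φ u) (h2 : 2 ≤ α 0) : u 1 = 0 := by
  have h1 : u 0 = 0 := h.apply_zero
  have h3 := h.map_of_lt 0 (by have := h.two_le; omega)
  have := h.apply_inner (x := 0) (t := 1) (by simp [h1, h3]; omega)
  simpa [blockPos_zero] using this

section AlphaOne

variable {l : ℕ}

lemma initial_letters (h : IsSimpleParry m α φ u) (h1 : α 0 = 1) (hl : l < m)
    (hlz : ∀ i, 1 ≤ i → i < l → α i = 0) {x : ℕ} (hx : 1 ≤ x) (hxl : x ≤ l) :
    blockPos φ u 1 x = x + 1 ∧ u x = x := by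
  induction x, hx using Nat.le_induction with
  | base =>
    have h0 := h.apply_zero
    have hp : blockPos φ u 1 1 = 2 := by
      have := blockPos_one_succ (φ := φ) (u := u) 0
      rw [blockPos_zero, h0, h.map_of_lt 0 (by omega)] at this
      simpa [h1] using this
    refine ⟨hp, ?_⟩
    have := h.apply_block_end (x := 0) (y := 1) (by omega) (by simp [hp])
    omega
  | succ x hx ih =>
    obtain ⟨ih1, ih2⟩ := ih (by omega)
    have hp : blockPos φ u 1 (x + 1) = x + 1 + 1 := by
      rw [blockPos_one_succ, ih1, ih2, h.map_of_lt x (by omega), hlz x hx (by omega)]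
      simp
    refine ⟨hp, ?_⟩
    rw [h.apply_block_end (x := x) (y := x + 1) (by omega) hp.symm, ih2]

lemma initial_occurrence (h : IsSimpleParry m α φ u) (h1 : α 0 = 1) (hl : l < m)
    (hlz : ∀ i, 1 ≤ i → i < l → α i = 0) (L : ℕ) :
    L ≤ l → ∀ j r, (∀ i, 1 ≤ i → i ≤ r → u (j + i) ≠ 0) → u (j + r) = L →
      ∃ p, p + r = L ∧ ∀ i ≤ r, u (p + i) = u (j + i) := by
  induction L with
  | zero =>
    intro _ j r hne hL
    have hr : r = 0 := by
      by_contra hr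
      exact hne r (by omega) le_rfl hL
    subst hr
    refine ⟨0, rfl, fun i hi => ?_⟩
    obtain rfl : i = 0 := by omega
    rw [hL, h.apply_zero]
  | succ L ih =>
    intro hLl j r hne hL
    obtain ⟨j', r', h2, h3, h4⟩ := h.exists_parent hne hL
    obtain ⟨p', hp', hm⟩ := ih (by omega) j' r' h2 h3
    obtain ⟨p, hp1, -, hp3⟩ := h4 p' hm
    rw [hp', (h.initial_letters h1 hl hlz (by omega) hLl).1] at hp3
    exact ⟨p, by omega, hp1⟩

lemma early_of_initial (h : IsSimpleParry m α φ u) (h1 : α 0 = 1) (hl : l < m) (hl1 : 1 ≤ l)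
    (hlz : ∀ i, 1 ≤ i → i < l → α i = 0) (hαl : 1 ≤ α l) (d : ℕ) :
    ∀ j r, (∀ i, 1 ≤ i → i ≤ r → u (j + i) ≠ 0) → u (j + r) = l + d →
      ∃ p < blockPos φ u (l + d) 1, (∀ i ≤ r, u (p + i) = u (j + i)) ∧ u (p + r + 1) = 0 := by
  induction d with
  | zero =>
    intro j r hne hL
    obtain ⟨p, hp, hm⟩ := h.initial_occurrence h1 hl hlz l le_rfl j r hne hL
    obtain ⟨h2, h3⟩ := h.initial_letters h1 hl hlz hl1 le_rfl
    refine ⟨p, ?_, hm, ?_⟩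
    · have := h.succ_le_length_iterW l
      rw [h.iterW_zero_length] at this
      simp only [add_zero]
      omega
    · rw [hp, ← h2]
      exact h.apply_block_start (h3.symm ▸ hαl)
  | succ d ih => exact fun j r hne hL => h.early_step ih hne hL

lemma apply_blockPos_one_of_lt (h : IsSimpleParry m α φ u) (h1 : α 0 = 1) (hl : l < m)
    (hl1 : 1 ≤ l) (hlz : ∀ i, 1 ≤ i → i < l → α i = 0) (s : ℕ) (hs : s < l) :
    u (blockPos φ u s 1) = s + 1 := by
  induction s with
  | zero =>
    have : blockPos φ u 0 1 = 1 := by simp [blockPos, iterW]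
    rw [this]
    exact (h.initial_letters h1 hl hlz le_rfl hl1).2
  | succ s ih =>
    have ih' := ih (by omega)
    have hlen : (φ (u (blockPos φ u s 1))).length = 1 := by
      rw [ih', h.map_of_lt _ (by omega), hlz _ (by omega) (by omega)]
      simp
    rw [h.blockPos_succ_one, h.apply_block_end (x := blockPos φ u s 1) (by omega)
      (by rw [blockPos_one_succ, hlen]), ih']

lemma apply_blockPos_one_of_ge (h : IsSimpleParry m α φ u) (h1 : α 0 = 1) (hl : l < m)
    (hl1 : 1 ≤ l) (hlz : ∀ i, 1 ≤ i → i < l → α i = 0) (hαl : 1 ≤ α l) (s : ℕ) (hs : l ≤ s) :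
    u (blockPos φ u s 1) = 0 := by
  induction s, hs using Nat.le_induction with
  | base =>
    obtain ⟨k, rfl⟩ := Nat.exists_eq_add_of_le' hl1
    rw [h.blockPos_succ_one]
    apply h.apply_block_start
    rwa [h.apply_blockPos_one_of_lt h1 hl hl1 hlz k (by omega)]
  | succ s _ ih =>
    rw [h.blockPos_succ_one]
    exact h.apply_block_start_zero ih

end AlphaOne

lemma blockPos_pos (h : IsSimpleParry m α φ u) (s : ℕ) : 1 ≤ blockPos φ u s 1 :=
  (h.blockPos_strictMono s).le_apply

lemma apply_blockPos_one_sub_one (h : IsSimpleParry m α φ u) (s : ℕ) (hs : s < m) :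
    u (blockPos φ u s 1 - 1) = s := by
  induction s with
  | zero =>
    have : blockPos φ u 0 1 = 1 := by simp [blockPos, iterW]
    rw [this]
    exact h.apply_zero
  | succ s ih =>
    have ih' := ih (by omega)
    have hp := h.blockPos_pos s
    have hp' := h.blockPos_pos (s + 1)
    rw [h.apply_block_end (x := blockPos φ u s 1 - 1) (by omega), ih']
    rw [Nat.sub_add_cancel hp, Nat.sub_add_cancel hp', h.blockPos_succ_one]

lemma apply_blockPos_m (h : IsSimpleParry m α φ u) : u (blockPos φ u m 1 - 1) = 0 := by
  have h2 := h.two_le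
  obtain ⟨k, rfl⟩ := Nat.exists_eq_add_of_le' (show 1 ≤ m by omega)
  have h3 := h.apply_blockPos_one_sub_one k (by omega)
  have hp := h.blockPos_pos k
  have h4 := blockPos_one_succ (φ := φ) (u := u) (blockPos φ u k 1 - 1)
  have h5 := h.length_map_pos (h.lt (blockPos φ u k 1 - 1))
  rw [Nat.sub_add_cancel hp, ← h.blockPos_succ_one] at h4
  have := h.apply_last_block (x := blockPos φ u k 1 - 1)
    (t := (φ (u (blockPos φ u k 1 - 1))).length - 1) (by omega) (by omega)
  rw [← this]
  congr 1
  omega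

/-- The two properties of the constant `R` used below. -/
lemma synchronization (h : IsSimpleParry m α φ u) {R : ℕ}
    (hR : R = if 2 ≤ α 0 then m - 1 else m + sInf {ℓ : ℕ | 1 ≤ ℓ ∧ 1 ≤ α ℓ} - 1) :
    u (blockPos φ u R 1) = 0 ∧
    ∀ j r, (∀ i, 1 ≤ i → i ≤ r → u (j + i) ≠ 0) →
      ∃ p < blockPos φ u R 1, (∀ i ≤ r, u (p + i) = u (j + i)) ∧ u (p + r + 1) = 0 := by
  have hm := h.two_le
  by_cases h2 : 2 ≤ α 0
  · rw [if_pos h2] at hR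
    have hu1 := h.apply_one_of_two_le h2
    have hb0 : blockPos φ u 0 1 = 1 := by simp [blockPos, iterW]
    constructor
    · clear hR
      induction R with
      | zero => rw [hb0]; exact hu1
      | succ s ih =>
        rw [h.blockPos_succ_one]
        exact h.apply_block_start_zero ih
    · intro j r hne
      obtain ⟨p, hp, h3⟩ := h.early_of_base (s := 0)
        ⟨0, by rw [hb0]; omega, h.apply_zero, hu1⟩ _ j r hne rfl
      have := h.lt (j + r)
      exact ⟨p, hp.trans_le (h.blockPos_one_mono (by omega)), h3⟩
  · have h1 : α 0 = 1 := by have := h.one_le_zero; omega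
    have hmem : m - 1 ∈ {ℓ : ℕ | 1 ≤ ℓ ∧ 1 ≤ α ℓ} := ⟨by omega, h.one_le_last⟩
    obtain ⟨hl1, hαl⟩ := Nat.sInf_mem ⟨_, hmem⟩
    have hl : sInf {ℓ : ℕ | 1 ≤ ℓ ∧ 1 ≤ α ℓ} < m := by
      have := Nat.sInf_le hmem
      omega
    have hlz : ∀ i, 1 ≤ i → i < sInf {ℓ : ℕ | 1 ≤ ℓ ∧ 1 ≤ α ℓ} → α i = 0 := by
      intro i hi hi2
      have := Nat.notMem_of_lt_sInf hi2
      simp only [Set.mem_ofPred_eq] at this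
      omega
    rw [if_neg h2] at hR
    generalize sInf {ℓ : ℕ | 1 ≤ ℓ ∧ 1 ≤ α ℓ} = l at *
    refine ⟨h.apply_blockPos_one_of_ge h1 hl hl1 hlz hαl R (by omega), ?_⟩
    intro j r hne
    have hlt := h.lt (j + r)
    by_cases hL : l ≤ u (j + r)
    · obtain ⟨d, hd⟩ := Nat.exists_eq_add_of_le hL
      obtain ⟨p, hp, h3⟩ := h.early_of_initial h1 hl hl1 hlz hαl d j r hne hd
      exact ⟨p, hp.trans_le (h.blockPos_one_mono (by omega)), h3⟩
    · have hp := h.blockPos_pos m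
      obtain ⟨p, hp, h3⟩ := h.early_of_base (s := m)
        ⟨blockPos φ u m 1 - 1, by omega, h.apply_blockPos_m, by
          rw [Nat.sub_add_cancel hp]
          exact h.apply_blockPos_one_of_ge h1 hl hl1 hlz hαl m hl.le⟩ _ j r hne rfl
      exact ⟨p, hp.trans_le (h.blockPos_one_mono (by omega)), h3⟩

lemma exists_early_factor (h : IsSimpleParry m α φ u) {R : ℕ}
    (hS : ∀ j r, (∀ i, 1 ≤ i → i ≤ r → u (j + i) ≠ 0) →
      ∃ p < blockPos φ u R 1, (∀ i ≤ r, u (p + i) = u (j + i)) ∧ u (p + r + 1) = 0)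
    {M n : ℕ} (hn : n ≤ blockPos φ u M 1) (i : ℕ) :
    ∃ i' < blockPos φ u (M + R) 1, seg u i' n = seg u i n := by
  have hmono := h.blockPos_strictMono M
  obtain ⟨j, hj1, hj2⟩ := exists_block hmono (blockPos_zero M) i
  obtain ⟨t, rfl⟩ := Nat.exists_eq_add_of_le hj1
  obtain ⟨c, p, hp, hc, hmatch, hlen⟩ : ∃ c p, p < blockPos φ u R 1 ∧ 1 ≤ c ∧
      (∀ i < c, u (p + i) = u (j + i)) ∧
      blockPos φ u M (j + 1) + n ≤ blockPos φ u M (j + c) := by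
    by_cases hz : ∃ r, u (j + r + 1) = 0
    · classical
      obtain ⟨p, hp, h1, h2⟩ := hS j (Nat.find hz) fun i hi1 hi2 => by
        have := Nat.find_min hz (m := i - 1) (by omega)
        rwa [show j + (i - 1) + 1 = j + i by omega] at this
      have h3 := Nat.find_spec hz
      generalize Nat.find hz = r at *
      refine ⟨r + 2, p, hp, by omega, ?_, ?_⟩
      · intro i hi
        by_cases hir : i ≤ r
        · exact h1 i hir
        · obtain rfl : i = r + 1 := by omega
          rw [← add_assoc, h2, ← add_assoc, h3]
      · have h4 := blockPos_add_right (φ := φ) (u := u) M (j + r + 1) 1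
        rw [seg_one, h3, h.iterW_zero_length] at h4
        have h5 := hmono.monotone (show j + 1 ≤ j + r + 1 by omega)
        rw [show j + (r + 2) = j + r + 1 + 1 by omega]
        omega
    · obtain ⟨p, hp, h1, -⟩ := hS j n fun i hi1 hi2 h0 => hz ⟨i - 1, by
        rwa [show j + (i - 1) + 1 = j + i by omega]⟩
      refine ⟨n + 1, p, hp, by omega, fun i hi => h1 i (by omega), ?_⟩
      rw [show j + (n + 1) = j + 1 + n by omega]
      have := hmono.add_le_nat n (j + 1)
      rwa [add_comm, add_comm (j + 1)]
  obtain ⟨l, hl1, hl2, hl3⟩ := h.transport M hmatch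
  obtain ⟨l', hl1', hl2', -⟩ := h.transport M (a := p) (b := j) (c := 1)
    fun i hi => hmatch i (by omega)
  refine ⟨blockPos φ u M p + t, ?_, seg_congr fun s hs => ?_⟩
  · rw [h.blockPos_add]
    have := hmono.monotone (show p + 1 ≤ blockPos φ u R 1 by omega)
    omega
  · rw [add_assoc, add_assoc]
    exact hl3 _ (by omega)

lemma parikh_seg_sub (u : ℕ → ℕ) (m n i : ℕ) :
    parikh m (seg u i n) - parikh m (pref u n) = parikh m (seg u n i) - parikh m (pref u i) := by
  have h1 : pref u i ++ seg u i n = pref u n ++ seg u n i := by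
    rw [← pref_add, ← pref_add, add_comm]
  have h2 := congrArg (parikh m) h1
  rw [parikh_append, parikh_append] at h2
  rw [sub_eq_sub_iff_add_eq_add, add_comm, h2, add_comm]

lemma relParikhSet_eq_prefixDiff {N n : ℕ}
    (hN : ∀ i, ∃ i' < N, seg u i' n = seg u i n) :
    relParikhSet m u n = prefixDiff m (pref u N) (seg u n N) := by
  ext v
  constructor
  · rintro ⟨w, ⟨i, hw⟩, rfl, rfl⟩
    obtain ⟨i', hi', hs⟩ := hN i
    refine ⟨i', by simpa using hi', ?_⟩
    rw [take_pref hi'.le, take_seg hi'.le, ← parikh_seg_sub, hs]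
    congr 2
  · rintro ⟨i, hi, rfl⟩
    rw [length_pref] at hi
    refine ⟨seg u i n, ⟨i, by simp [seg]⟩, by simp, ?_⟩
    rw [take_pref hi.le, take_seg hi.le, parikh_seg_sub]

lemma relParikhSet_eq_of_coDecomp (h : IsSimpleParry m α φ u) {R : ℕ}
    (hR : R = if 2 ≤ α 0 then m - 1 else m + sInf {ℓ : ℕ | 1 ≤ ℓ ∧ 1 ≤ α ℓ} - 1)
    {k q n K Q : ℕ} (hn : n ≤ (iterW φ (k + K) [0]).length) (hQ : Q ≤ (iterW φ K [0]).length)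
    (hfact : pref u n = iterW φ k (pref u Q) ++ pref u q)
    {r : ℕ} {z zt : Fin (r + 1) → List ℕ}
    (hz : IsCoDecomp m (iterW φ (K + R) [0])
      ((iterW φ (K + R) [0] ++ pref u Q).drop Q) z zt)
    (hq : ∀ pr ∈ { pr : List ℕ × List ℕ | ∃ j, pr = (z j, zt j) },
      pref u q <+: iterW φ k pr.2) :
    relParikhSet m u n =
      { v | ∃ pr ∈ { pr : List ℕ × List ℕ | ∃ j, pr = (z j, zt j) },
        v ∈ prefixDiff m (iterW φ k pr.1) (conj (pref u q) (iterW φ k pr.2)) } := by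
  obtain ⟨hR0, hS⟩ := h.synchronization hR
  obtain ⟨-, -, hzf, hztf, hpar⟩ := hz
  rw [h.iterW_zero_length] at hn hQ
  have hv : iterW φ (K + R) [0] = pref u (blockPos φ u (K + R) 1) := by
    rw [h.fix, h.iterW_zero_length]
  have hQ' : Q ≤ blockPos φ u (K + R) 1 := hQ.trans (h.blockPos_one_mono (by omega))
  rw [hv] at hzf hztf
  obtain ⟨b, hb⟩ := Nat.exists_eq_add_of_le hQ'
  have hw : pref u Q ++ (List.ofFn zt).flatten = pref u (blockPos φ u (K + R) 1) ++ pref u Q := by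
    rw [hztf, hb, pref_add]
    simp
  have hlt : ∀ x ∈ pref u (blockPos φ u (K + R) 1) ++ pref u Q, x < m := by
    intro x hx
    rcases List.mem_append.mp hx with hx | hx
    · exact h.pref_lt _ x hx
    · exact h.pref_lt _ x hx
  have hperm : ∀ j, (z j).Perm (zt j) := by
    intro j
    refine perm_of_parikh_eq (m := m) ?_ ?_ (hpar j)
    · intro x hx
      apply h.pref_lt (blockPos φ u (K + R) 1)
      rw [← hzf]
      exact List.mem_flatten.mpr ⟨z j, List.mem_ofFn.mpr ⟨j, rfl⟩, hx⟩
    · intro x hx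
      apply hlt
      rw [← hw]
      exact List.mem_append_right _
        (List.mem_flatten.mpr ⟨zt j, List.mem_ofFn.mpr ⟨j, rfl⟩, hx⟩)
  set L : List (List ℕ × List ℕ) := List.ofFn fun j => (z j, zt j) with hLdef
  have hmem : ∀ pr, pr ∈ L ↔ pr ∈ { pr : List ℕ × List ℕ | ∃ j, pr = (z j, zt j) } := by
    intro pr
    rw [hLdef, List.mem_ofFn]
    exact exists_congr fun j => eq_comm
  have hLz : L.map Prod.fst = List.ofFn z := by simp [hLdef, List.map_ofFn, Function.comp_def]
  have hLzt : L.map Prod.snd = List.ofFn zt := by simp [hLdef, List.map_ofFn, Function.comp_def]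
  have hA : (L.map fun pr => iterW φ k pr.1).flatten = pref u (blockPos φ u (k + K + R) 1) := by
    rw [add_assoc, h.blockPos_add k, ← h.iterW_pref, ← hzf, iterW_flatten, ← hLz, List.map_map]
    rfl
  have hC : (L.map fun pr => iterW φ k pr.2).flatten = iterW φ k (List.ofFn zt).flatten := by
    rw [iterW_flatten, ← hLzt, List.map_map]
    rfl
  have hper : seg u (blockPos φ u (k + K + R) 1) n = pref u n := by
    have h1 := h.iterW_seg (k + K) (blockPos φ u R 1) 1
    rw [seg_one, hR0, ← h.blockPos_add, h.iterW_zero_length, h.fix, h.iterW_zero_length] at h1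
    have h2 := congrArg (List.take n) h1
    rw [take_pref hn, take_seg hn] at h2
    exact h2.symm
  have hB : (L.map fun pr => conj (pref u q) (iterW φ k pr.2)).flatten =
      seg u n (blockPos φ u (k + K + R) 1) := by
    have h1 := append_flatten_conj (pref u q) L (fun pr => iterW φ k pr.2)
      fun pr hpr => hq pr ((hmem pr).mp hpr)
    apply List.append_cancel_left (as := pref u n)
    rw [← pref_add, add_comm, pref_add, hper, hfact, List.append_assoc, h1, hC,
      ← List.append_assoc, ← iterW_append, hw, iterW_append, h.iterW_pref, ← h.blockPos_add,
      ← add_assoc, List.append_assoc]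
  rw [relParikhSet_eq_prefixDiff fun i => h.exists_early_factor hS hn i, ← hA, ← hB,
    prefixDiff_flatten]
  · ext v
    simp only [hmem, Set.mem_ofPred_eq]
  · intro pr hpr
    rw [hmem] at hpr
    have hpre := hq pr hpr
    obtain ⟨j, rfl⟩ := hpr
    exact (iterW_perm k (hperm j)).trans (perm_conj hpre)

end IsSimpleParry

theorem stmt14
    (m : ℕ) (hm : 2 ≤ m) (α : ℕ → ℕ) (hα0 : 1 ≤ α 0)
    (hαle : ∀ ℓ, ℓ < m → α ℓ ≤ α 0) (hαlast : 1 ≤ α (m - 1))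
    (φ : ℕ → List ℕ)
    (hφ : ∀ ℓ, ℓ + 1 < m → φ ℓ = List.replicate (α ℓ) 0 ++ [ℓ + 1])
    (hφlast : φ (m - 1) = List.replicate (α (m - 1)) 0)
    (u : ℕ → ℕ) (hu : ∀ i, u i < m)
    (hufix : ∀ k : ℕ, iterW φ k [0] = pref u (iterW φ k [0]).length)
    (R : ℕ)
    (hR : R = if 2 ≤ α 0 then m - 1 else m + sInf {ℓ : ℕ | 1 ≤ ℓ ∧ 1 ≤ α ℓ} - 1)
    (k q n₁ n₂ K₁ K₂ Q₁ Q₂ : ℕ)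
    (hn₁ : n₁ ≤ (iterW φ (k + K₁) [0]).length) (hQ₁ : Q₁ ≤ (iterW φ K₁ [0]).length)
    (hfact₁ : pref u n₁ = iterW φ k (pref u Q₁) ++ pref u q)
    (hn₂ : n₂ ≤ (iterW φ (k + K₂) [0]).length) (hQ₂ : Q₂ ≤ (iterW φ K₂ [0]).length)
    (hfact₂ : pref u n₂ = iterW φ k (pref u Q₂) ++ pref u q)
    (hex : ∃ (h₁ h₂ : ℕ) (z₁ zt₁ : Fin (h₁ + 1) → List ℕ)
        (z₂ zt₂ : Fin (h₂ + 1) → List ℕ),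
      IsCoDecomp m (iterW φ (K₁ + R) [0])
        ((iterW φ (K₁ + R) [0] ++ pref u Q₁).drop Q₁) z₁ zt₁ ∧
      IsCoDecomp m (iterW φ (K₂ + R) [0])
        ((iterW φ (K₂ + R) [0] ++ pref u Q₂).drop Q₂) z₂ zt₂ ∧
      { pr : List ℕ × List ℕ | ∃ j, pr = (z₁ j, zt₁ j) } =
        { pr : List ℕ × List ℕ | ∃ j, pr = (z₂ j, zt₂ j) } ∧
      (∀ pr ∈ { pr : List ℕ × List ℕ | ∃ j, pr = (z₁ j, zt₁ j) },
        pref u q <+: iterW φ k pr.2)) :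
    relParikhSet m u n₁ = relParikhSet m u n₂ := by
  have h : IsSimpleParry m α φ u := ⟨hm, hα0, hαlast, hφ, hφlast, hu, hufix⟩
  obtain ⟨h₁, h₂, z₁, zt₁, z₂, zt₂, hz₁, hz₂, hset, hq⟩ := hex
  rw [h.relParikhSet_eq_of_coDecomp hR hn₁ hQ₁ hfact₁ hz₁ hq,
    h.relParikhSet_eq_of_coDecomp hR hn₂ hQ₂ hfact₂ hz₂ (hset ▸ hq), hset]
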